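/- Let $X$ be a separable, reflexive Banach space, $p \in [1,\infty)$, $\mu_0 \in \mathscr{P}_p$, $T_0 := L^p(X \to X, \mu_0)$, and $\Psi(\phi) := \mu_0 \circ \phi^{-1}$. If $u \in C_b^1(\mathscr{P}_p)$ (i.e., $u$ is continuous, intrinsically differentiable with intrinsic derivative $Du(\mu) \in L^{p^*}(X \to X^*, \mu)$, first-order Taylor expansion along pushforwards, $Du$ jointly continuous in $(\mu, x)$ and uniformly bounded), then $u \circ \Psi$ is Fréchet differentiable on $T_0$ with $\nabla(u \circ \Psi)(\phi) = Du(\Psi(\phi)) \circ \phi \in L^{p^*}(X \to X^*, \mu_0)$, and $\|\nabla(u\circ\Psi)(\phi)\|_{L^{p^*}(X\to X^*,\mu_0)} = \|Du(\Psi(\phi))\|_{L^{p^*}(X\to X^*,\Psi(\phi))}$. -/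

import Mathlib

open MeasureTheory
open scoped ENNReal

/-- The `p`-Wasserstein distance between two measures on a normed space. -/
noncomputable def Wp {X : Type*} [NormedAddCommGroup X] [MeasurableSpace X]
    (p : ℝ) (μ ν : Measure X) : ℝ :=
  sInf { c : ℝ | ∃ π : Measure (X × X), IsProbabilityMeasure π ∧
    π.map Prod.fst = μ ∧ π.map Prod.snd = ν ∧
    c = (∫ z, ‖z.1 - z.2‖ ^ p ∂π) ^ (1 / p) }

/-- Membership in the `p`-Wasserstein space. -/
def InPp {X : Type*} [NormedAddCommGroup X] [MeasurableSpace X]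
    (p : ℝ) (μ : Measure X) : Prop :=
  IsProbabilityMeasure μ ∧ Integrable (fun x => ‖x‖ ^ p) μ

open Filter Topology

/-- The hypotheses on `u` and `Du`, bundled. -/
structure CB {X : Type*} [NormedAddCommGroup X] [NormedSpace ℝ X]
    [MeasurableSpace X] (p : ℝ) (u : Measure X → ℝ) (Du : Measure X → X → (X →L[ℝ] ℝ)) :
    Prop where
  bdd : ∃ C : ℝ, ∀ μ : Measure X, ∀ x : X, InPp p μ → |u μ| + ‖Du μ x‖ ≤ C
  contu : ∀ μ : Measure X, InPp p μ → ∀ ε : ℝ, 0 < ε → ∃ δ : ℝ, 0 < δ ∧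
      ∀ ν : Measure X, InPp p ν → Wp p μ ν < δ → |u ν - u μ| < ε
  taylor : ∀ μ : Measure X, InPp p μ → ∀ ε : ℝ, 0 < ε → ∃ δ : ℝ, 0 < δ ∧
      ∀ φ : X → X, Measurable φ → Integrable (fun x => ‖φ x‖ ^ p) μ →
        (∫ x, ‖φ x‖ ^ p ∂μ) ^ (1 / p) ≤ δ →
        abs (u (μ.map (fun x => x + φ x)) - u μ - ∫ x, Du μ x (φ x) ∂μ) ≤
          ε * (∫ x, ‖φ x‖ ^ p ∂μ) ^ (1 / p)
  contD : ∀ (μ : Measure X) (x : X), InPp p μ → ∀ ε : ℝ, 0 < ε →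
      ∃ δ : ℝ, 0 < δ ∧ ∀ (ν : Measure X) (y : X), InPp p ν →
        Wp p μ ν < δ → ‖y - x‖ < δ → ‖Du ν y - Du μ x‖ < ε

set_option linter.unusedSectionVars false
set_option linter.style.haveILetI false

section basic
variable {X : Type*} [NormedAddCommGroup X] [NormedSpace ℝ X]
    [MeasurableSpace X] [BorelSpace X] [SecondCountableTopology X]

lemma Wp_le_of_coupling {p : ℝ} {μ ν : Measure X} (π : Measure (X × X))
    [IsProbabilityMeasure π] (h1 : π.map Prod.fst = μ) (h2 : π.map Prod.snd = ν) :
    Wp p μ ν ≤ (∫ z, ‖z.1 - z.2‖ ^ p ∂π) ^ (1 / p) := by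
  refine csInf_le ⟨0, ?_⟩ ⟨π, inferInstance, h1, h2, rfl⟩
  rintro c ⟨π', -, -, -, rfl⟩
  exact Real.rpow_nonneg (integral_nonneg fun z => Real.rpow_nonneg (norm_nonneg _) _) _

lemma Wp_map_le {p : ℝ} {Ω : Type*} [MeasurableSpace Ω] (m : Measure Ω)
    [IsProbabilityMeasure m] {f g : Ω → X} (hf : Measurable f) (hg : Measurable g) :
    Wp p (m.map f) (m.map g) ≤ (∫ w, ‖f w - g w‖ ^ p ∂m) ^ (1 / p) := by
  have hm : Measurable (fun w => (f w, g w)) := hf.prodMk hg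
  haveI : IsProbabilityMeasure (m.map (fun w => (f w, g w))) :=
    Measure.isProbabilityMeasure_map hm.aemeasurable
  refine (Wp_le_of_coupling (m.map (fun w => (f w, g w))) ?_ ?_).trans_eq ?_
  · rw [Measure.map_map measurable_fst hm]; rfl
  · rw [Measure.map_map measurable_snd hm]; rfl
  · rw [integral_map hm.aemeasurable]
    exact (Measurable.pow_const (by fun_prop) _).aestronglyMeasurable

lemma ofReal_ne_zero' {p : ℝ} (hp : 1 ≤ p) : ENNReal.ofReal p ≠ 0 := by
  have : 0 < p := by linarith
  simpa using this

lemma Lp_norm_eq {p : ℝ} (hp : 1 ≤ p) {m : Measure X} (φ : Lp X (ENNReal.ofReal p) m) :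
    ‖φ‖ = (∫ x, ‖φ x‖ ^ p ∂m) ^ (1 / p) := by
  rw [Lp.norm_def, (Lp.memLp φ).eLpNorm_eq_integral_rpow_norm (ofReal_ne_zero' hp)
    ENNReal.ofReal_ne_top, ENNReal.toReal_ofReal, ENNReal.toReal_ofReal (by linarith), one_div]
  exact Real.rpow_nonneg (integral_nonneg fun z => Real.rpow_nonneg (norm_nonneg _) _) _

lemma Lp_meas {q : ℝ≥0∞} {m : Measure X} (φ : Lp X q m) : Measurable φ :=
  (Lp.stronglyMeasurable φ).measurable

lemma Lp_int {p : ℝ} (hp : 1 ≤ p) {m : Measure X} (φ : Lp X (ENNReal.ofReal p) m) :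
    Integrable (fun x => ‖φ x‖ ^ p) m := by
  have := (Lp.memLp φ).integrable_norm_rpow (ofReal_ne_zero' hp) ENNReal.ofReal_ne_top
  rwa [ENNReal.toReal_ofReal (by linarith)] at this

lemma inPp_map_of {p : ℝ} {m : Measure X} [IsProbabilityMeasure m] {φ : X → X}
    (hφ : Measurable φ) (hi : Integrable (fun x => ‖φ x‖ ^ p) m) : InPp p (m.map φ) := by
  refine ⟨Measure.isProbabilityMeasure_map hφ.aemeasurable, ?_⟩
  rw [integrable_map_measure ?_ hφ.aemeasurable]
  · exact hi
  · exact (Measurable.pow_const (by fun_prop) _).aestronglyMeasurable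

lemma inPp_map {p : ℝ} (hp : 1 ≤ p) {m : Measure X} [IsProbabilityMeasure m]
    (φ : Lp X (ENNReal.ofReal p) m) : InPp p (m.map φ) :=
  inPp_map_of (Lp_meas φ) (Lp_int hp φ)

lemma Wp_Lp_le {p : ℝ} (hp : 1 ≤ p) {m : Measure X} [IsProbabilityMeasure m]
    (φ ψ : Lp X (ENNReal.ofReal p) m) : Wp p (m.map φ) (m.map ψ) ≤ ‖φ - ψ‖ := by
  refine (Wp_map_le m (Lp_meas φ) (Lp_meas ψ)).trans_eq ?_
  rw [Lp_norm_eq hp]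
  congr 1
  refine integral_congr_ae ?_
  filter_upwards [Lp.coeFn_sub φ ψ] with x hx
  simp only [hx, Pi.sub_apply]

lemma Wp_self_le {p : ℝ} (hp : 1 ≤ p) (m : Measure X) [IsProbabilityMeasure m] :
    Wp p m m ≤ 0 := by
  have h := Wp_map_le (p := p) m (measurable_id (α := X)) (measurable_id (α := X))
  have hp0 : p ≠ 0 := by linarith
  simpa [Measure.map_id, Real.zero_rpow, hp0] using h

variable {p : ℝ} {u : Measure X → ℝ} {Du : Measure X → X → (X →L[ℝ] ℝ)}

lemma CB.cont (H : CB p u Du) (hp : 1 ≤ p) {μ : Measure X} (hμ : InPp p μ) :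
    Continuous (Du μ) := by
  haveI := hμ.1
  rw [Metric.continuous_iff]
  intro x ε hε
  obtain ⟨δ, hδ, h⟩ := H.contD μ x hμ ε hε
  refine ⟨δ, hδ, fun y hy => ?_⟩
  rw [dist_eq_norm] at hy ⊢
  exact h μ y hμ ((Wp_self_le hp μ).trans_lt hδ) hy

lemma CB.bound (H : CB p u Du) : ∃ C : ℝ, 0 ≤ C ∧ ∀ μ x, InPp p μ → ‖Du μ x‖ ≤ C := by
  obtain ⟨C, hC⟩ := H.bdd
  refine ⟨max C 0, le_max_right _ _, fun μ x h => ?_⟩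
  have := hC μ x h
  have h2 := abs_nonneg (u μ)
  exact le_trans (by linarith) (le_max_left _ _)

lemma CB.meas (H : CB p u Du) (hp : 1 ≤ p) {m : Measure X} [IsProbabilityMeasure m]
    (φ : Lp X (ENNReal.ofReal p) m) :
    AEStronglyMeasurable (fun x => Du (m.map φ) (φ x)) m :=
  (H.cont hp (inPp_map hp φ)).comp_aestronglyMeasurable (Lp.aestronglyMeasurable φ)

lemma pair_meas {m : Measure X} {f : X → (X →L[ℝ] ℝ)} {g : X → X}
    (hf : AEStronglyMeasurable f m) (hg : AEStronglyMeasurable g m) :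
    AEStronglyMeasurable (fun x => f x (g x)) m :=
  isBoundedBilinearMap_apply.continuous.comp_aestronglyMeasurable (hf.prodMk hg)

lemma Lp_integrable (hp : 1 ≤ p) {m : Measure X} [IsProbabilityMeasure m]
    (ψ : Lp X (ENNReal.ofReal p) m) : Integrable ψ m :=
  (Lp.memLp ψ).integrable (by simpa using ENNReal.ofReal_le_ofReal hp)

lemma Lp_integral_le (hp : 1 ≤ p) {m : Measure X} [IsProbabilityMeasure m]
    (ψ : Lp X (ENNReal.ofReal p) m) : ∫ x, ‖ψ x‖ ∂m ≤ ‖ψ‖ := by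
  have h1 := eLpNorm_le_eLpNorm_of_exponent_le (μ := m) (p := 1) (q := ENNReal.ofReal p)
    (f := ψ) (by simpa using ENNReal.ofReal_le_ofReal hp) (Lp.aestronglyMeasurable ψ)
  rw [integral_norm_eq_lintegral_enorm (Lp.aestronglyMeasurable ψ), ← eLpNorm_one_eq_lintegral_enorm,
    Lp.norm_def]
  exact ENNReal.toReal_mono (Lp.eLpNorm_ne_top ψ) h1

lemma CB.pair_int (H : CB p u Du) (hp : 1 ≤ p) {m : Measure X} [IsProbabilityMeasure m]
    (φ ψ : Lp X (ENNReal.ofReal p) m) :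
    Integrable (fun x => Du (m.map φ) (φ x) (ψ x)) m := by
  obtain ⟨C, hC0, hC⟩ := H.bound
  refine ((Lp_integrable hp ψ).norm.const_mul C).mono'
    (pair_meas (H.meas hp φ) (Lp.aestronglyMeasurable ψ)) (Eventually.of_forall fun x => ?_)
  exact ((Du (m.map φ) (φ x)).le_opNorm _).trans
    (mul_le_mul_of_nonneg_right (hC _ _ (inPp_map hp φ)) (norm_nonneg _))

/-- joint sequential continuity of `Du` -/
lemma CB.tendsto (H : CB p u Du) {ι : Type*} {l : Filter ι} {μ : Measure X} (hμ : InPp p μ)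
    {x : X} {ν : ι → Measure X} {y : ι → X} (hν : ∀ i, InPp p (ν i))
    {w : ι → ℝ} (hw : ∀ i, Wp p μ (ν i) ≤ w i) (hw0 : Tendsto w l (𝓝 0))
    (hy : Tendsto y l (𝓝 x)) : Tendsto (fun i => Du (ν i) (y i)) l (𝓝 (Du μ x)) := by
  rw [Metric.tendsto_nhds]
  intro ε hε
  obtain ⟨δ, hδ, h⟩ := H.contD μ x hμ ε hε
  filter_upwards [hw0.eventually (gt_mem_nhds hδ), Metric.tendsto_nhds.1 hy δ hδ] with i h1 h2
  rw [dist_eq_norm] at h2 ⊢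
  exact h _ _ (hν i) ((hw i).trans_lt h1) h2

lemma CB.subseq (H : CB p u Du) (hp : 1 ≤ p) {m : Measure X} [IsProbabilityMeasure m]
    [Fact (1 ≤ ENNReal.ofReal p)]
    {f : ℕ → Lp X (ENNReal.ofReal p) m} {φ : Lp X (ENNReal.ofReal p) m}
    (hf : Tendsto f atTop (𝓝 φ)) : ∃ ms : ℕ → ℕ, StrictMono ms ∧
      ∀ᵐ x ∂m, Tendsto (fun n => Du (m.map (f (ms n))) (f (ms n) x)) atTop
        (𝓝 (Du (m.map φ) (φ x))) := by
  obtain ⟨ms, hms, h⟩ := (tendstoInMeasure_of_tendsto_Lp hf).exists_seq_tendsto_ae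
  refine ⟨ms, hms, ?_⟩
  filter_upwards [h] with x hx
  refine H.tendsto (inPp_map hp φ) (fun n => inPp_map hp _) (fun n => Wp_Lp_le hp φ _)
    (w := fun n => ‖φ - f (ms n)‖) ?_ hx
  have := (tendsto_const_nhds (x := φ)).sub (hf.comp hms.tendsto_atTop)
  simpa using this.norm

/-- The pairing `⟨Du(L φ)(φ), ψ⟩`. -/
noncomputable def pairH (Du : Measure X → X → (X →L[ℝ] ℝ)) {q : ℝ≥0∞} {m : Measure X}
    (φ ψ : Lp X q m) : ℝ := ∫ x, Du (m.map φ) (φ x) (ψ x) ∂m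

lemma CB.pair_sub (H : CB p u Du) (hp : 1 ≤ p) {m : Measure X} [IsProbabilityMeasure m]
    (φ ψ ψ' : Lp X (ENNReal.ofReal p) m) :
    pairH Du φ (ψ - ψ') = pairH Du φ ψ - pairH Du φ ψ' := by
  unfold pairH
  rw [← integral_sub (H.pair_int hp φ ψ) (H.pair_int hp φ ψ')]
  refine integral_congr_ae ?_
  filter_upwards [Lp.coeFn_sub ψ ψ'] with x hx
  simp only [hx, Pi.sub_apply, map_sub]

lemma CB.pair_bound (H : CB p u Du) (hp : 1 ≤ p) : ∃ C : ℝ, ∀ {m : Measure X}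
    [IsProbabilityMeasure m]
    (φ ψ : Lp X (ENNReal.ofReal p) m), |pairH Du φ ψ| ≤ C * ‖ψ‖ := by
  obtain ⟨C, hC0, hC⟩ := H.bound
  refine ⟨C, fun {m} _ φ ψ => ?_⟩
  rw [pairH, ← Real.norm_eq_abs]
  refine (norm_integral_le_of_norm_le ((Lp_integrable hp ψ).norm.const_mul C)
    (Eventually.of_forall fun x => ?_)).trans ?_
  · exact ((Du (m.map φ) (φ x)).le_opNorm _).trans
      (mul_le_mul_of_nonneg_right (hC _ _ (inPp_map hp φ)) (norm_nonneg _))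
  · rw [integral_const_mul]
    exact mul_le_mul_of_nonneg_left (Lp_integral_le hp ψ) hC0

lemma CB.pair_cont (H : CB p u Du) (hp : 1 ≤ p) {m : Measure X} [IsProbabilityMeasure m]
    [Fact (1 ≤ ENNReal.ofReal p)] :
    Continuous (fun z : Lp X (ENNReal.ofReal p) m × Lp X (ENNReal.ofReal p) m =>
      pairH Du z.1 z.2) := by
  obtain ⟨C, hC0, hC⟩ := H.bound
  obtain ⟨C', hC'⟩ := H.pair_bound hp
  rw [continuous_iff_seqContinuous]
  intro z z0 hz
  refine tendsto_of_subseq_tendsto fun ns hns => ?_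
  have hz' := hz.comp hns
  have hz1 : Tendsto (fun n => (z (ns n)).1) atTop (𝓝 z0.1) :=
    (continuous_fst.tendsto _).comp hz'
  have hz2 : Tendsto (fun n => (z (ns n)).2) atTop (𝓝 z0.2) :=
    (continuous_snd.tendsto _).comp hz'
  obtain ⟨ms, hms, hae⟩ := H.subseq hp hz1
  refine ⟨ms, ?_⟩
  have hA : Tendsto (fun n => pairH Du (z (ns (ms n))).1 z0.2) atTop (𝓝 (pairH Du z0.1 z0.2)) := by
    refine tendsto_integral_of_dominated_convergence (fun x => C * ‖z0.2 x‖)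
      (fun n => (H.pair_int hp _ _).1) ((Lp_integrable hp z0.2).norm.const_mul C)
      (fun n => Eventually.of_forall fun x => ?_) ?_
    · exact (ContinuousLinearMap.le_opNorm _ _).trans
        (mul_le_mul_of_nonneg_right (hC _ _ (inPp_map hp _)) (norm_nonneg _))
    · filter_upwards [hae] with x hx
      exact ((ContinuousLinearMap.apply ℝ ℝ (z0.2 x)).continuous.tendsto _).comp hx
  have hB : Tendsto (fun n => pairH Du (z (ns (ms n))).1 ((z (ns (ms n))).2 - z0.2)) atTop
      (𝓝 0) := by
    refine squeeze_zero_norm (fun n => hC' _ _) ?_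
    have := ((hz2.comp hms.tendsto_atTop).sub_const z0.2).norm.const_mul C'
    simpa using this
  have := hA.add hB
  simp only [H.pair_sub hp] at this
  simpa using this

lemma CB.u_cont (H : CB p u Du) (hp : 1 ≤ p) {m : Measure X} [IsProbabilityMeasure m]
    [Fact (1 ≤ ENNReal.ofReal p)] :
    Continuous (fun φ : Lp X (ENNReal.ofReal p) m => u (m.map φ)) := by
  rw [Metric.continuous_iff]
  intro φ ε hε
  obtain ⟨δ, hδ, h⟩ := H.contu _ (inPp_map hp φ) ε hε
  refine ⟨δ, hδ, fun ψ hψ => ?_⟩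
  refine h _ (inPp_map hp ψ) ((Wp_Lp_le hp φ ψ).trans_lt ?_)
  rwa [dist_comm, dist_eq_norm] at hψ

end basic
section formula
variable {X : Type*} [NormedAddCommGroup X] [NormedSpace ℝ X]
    [MeasurableSpace X] [BorelSpace X] [SecondCountableTopology X]
variable {p : ℝ} {u : Measure X → ℝ} {Du : Measure X → X → (X →L[ℝ] ℝ)}

/-- Consequence of Taylor for directions factoring through the base point. -/
lemma CB.taylor_factor (H : CB p u Du) (hp : 1 ≤ p) {m : Measure X} [IsProbabilityMeasure m]
    [Fact (1 ≤ ENNReal.ofReal p)] (f : Lp X (ENNReal.ofReal p) m) (ε : ℝ) (hε : 0 < ε) :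
    ∃ δ : ℝ, 0 < δ ∧ ∀ (ψ : Lp X (ENNReal.ofReal p) m) (Θ : X → X), Measurable Θ →
      (∀ᵐ x ∂m, ψ x = Θ (f x)) → ‖ψ‖ ≤ δ →
      |u (m.map ⇑(f + ψ)) - u (m.map f) - pairH Du f ψ| ≤ ε * ‖ψ‖ := by
  obtain ⟨δ, hδ, h⟩ := H.taylor _ (inPp_map hp f) ε hε
  refine ⟨δ, hδ, fun ψ Θ hΘ hfac hψ => ?_⟩
  have hcongr : (fun x => ‖Θ (f x)‖ ^ p) =ᵐ[m] fun x => ‖ψ x‖ ^ p := by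
    filter_upwards [hfac] with x hx
    simp only [hx]
  have hmeas : AEStronglyMeasurable (fun y => ‖Θ y‖ ^ p) (m.map f) :=
    (Measurable.pow_const (by fun_prop) _).aestronglyMeasurable
  have hi : Integrable (fun y => ‖Θ y‖ ^ p) (m.map f) := by
    rw [integrable_map_measure hmeas (Lp_meas f).aemeasurable]
    exact (Lp_int hp ψ).congr hcongr.symm
  have hn : (∫ y, ‖Θ y‖ ^ p ∂(m.map f)) ^ (1 / p) = ‖ψ‖ := by
    rw [integral_map (Lp_meas f).aemeasurable hmeas, Lp_norm_eq hp]
    congr 1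
    exact integral_congr_ae hcongr
  have key := h Θ hΘ hi (by rw [hn]; exact hψ)
  rw [hn, integral_map (Lp_meas f).aemeasurable
    (pair_meas (H.cont hp (inPp_map hp f)).aestronglyMeasurable hΘ.aestronglyMeasurable),
    Measure.map_map (by fun_prop) (Lp_meas f)] at key
  have e1 : m.map ((fun x => x + Θ x) ∘ f) = m.map ⇑(f + ψ) := by
    refine Measure.map_congr ?_
    filter_upwards [hfac, Lp.coeFn_add f ψ] with x hx hx2
    simp only [hx2, Function.comp, Pi.add_apply, hx]
  have e2 : ∫ x, Du (m.map f) (f x) (Θ (f x)) ∂m = pairH Du f ψ := by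
    refine integral_congr_ae ?_
    filter_upwards [hfac] with x hx
    simp only [hx]
  rwa [e1, e2] at key

lemma CB.pair_smul (H : CB p u Du) (hp : 1 ≤ p) {m : Measure X} [IsProbabilityMeasure m]
    [Fact (1 ≤ ENNReal.ofReal p)] (φ ψ : Lp X (ENNReal.ofReal p) m) (s : ℝ) :
    pairH Du φ (s • ψ) = s * pairH Du φ ψ := by
  unfold pairH
  rw [← integral_const_mul]
  refine integral_congr_ae ?_
  filter_upwards [Lp.coeFn_smul s ψ] with x hx
  simp only [hx, Pi.smul_apply, map_smul, smul_eq_mul]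

lemma CB.deriv_factor (H : CB p u Du) (hp : 1 ≤ p) {m : Measure X} [IsProbabilityMeasure m]
    [Fact (1 ≤ ENNReal.ofReal p)] (φ ψ : Lp X (ENNReal.ofReal p) m) (t : ℝ)
    (Θ : X → X) (hΘ : Measurable Θ)
    (hfac : ∀ᵐ x ∂m, ψ x = Θ ((φ + t • ψ : Lp X (ENNReal.ofReal p) m) x)) :
    HasDerivAt (fun s : ℝ => u (m.map ⇑(φ + s • ψ))) (pairH Du (φ + t • ψ) ψ) t := by
  rw [hasDerivAt_iff_isLittleO, Asymptotics.isLittleO_iff]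
  intro c hc
  have hK : 0 < ‖ψ‖ + 1 := by positivity
  obtain ⟨δ, hδ, h⟩ := H.taylor_factor hp (φ + t • ψ) (c / (‖ψ‖ + 1)) (by positivity)
  have hev : ∀ᶠ s in 𝓝 t, ‖s - t‖ < δ / (‖ψ‖ + 1) := by
    have := Metric.ball_mem_nhds t (show 0 < δ / (‖ψ‖ + 1) by positivity)
    filter_upwards [this] with s hs
    rwa [← dist_eq_norm]
  filter_upwards [hev] with s hs
  have hle : ‖s - t‖ * ‖ψ‖ ≤ ‖s - t‖ * (‖ψ‖ + 1) := by gcongr; linarith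
  have h1 := h ((s - t) • ψ) (fun y => (s - t) • Θ y) (hΘ.const_smul _) ?_ ?_
  · have e : φ + t • ψ + (s - t) • ψ = φ + s • ψ := by rw [sub_smul]; abel
    rw [e, H.pair_smul hp] at h1
    rw [Real.norm_eq_abs, smul_eq_mul]
    refine h1.trans ?_
    rw [norm_smul]
    calc c / (‖ψ‖ + 1) * (‖s - t‖ * ‖ψ‖) ≤ c / (‖ψ‖ + 1) * (‖s - t‖ * (‖ψ‖ + 1)) := by gcongr
      _ = c * ‖s - t‖ := by field_simp
  · filter_upwards [hfac, Lp.coeFn_smul (s - t) ψ] with x hx hx2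
    simp only [hx2, Pi.smul_apply]
    rw [← hx]
  · rw [norm_smul]
    refine hle.trans ?_
    rw [lt_div_iff₀ hK] at hs
    exact hs.le

lemma simple_factor (f g : SimpleFunc X X) :
    ∃ B : Set ℝ, B.Countable ∧ ∀ t ∉ B, ∃ Θ : X → X, Measurable Θ ∧
      ∀ x, g x = Θ (f x + t • g x) := by
  classical
  refine ⟨⋃ a ∈ f.range, ⋃ a' ∈ f.range, ⋃ b ∈ g.range, ⋃ b' ∈ g.range,
    {t : ℝ | b ≠ b' ∧ a + t • b = a' + t • b'}, ?_, ?_⟩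
  · refine Set.Countable.biUnion (Finset.countable_toSet _) fun a _ => ?_
    refine Set.Countable.biUnion (Finset.countable_toSet _) fun a' _ => ?_
    refine Set.Countable.biUnion (Finset.countable_toSet _) fun b _ => ?_
    refine Set.Countable.biUnion (Finset.countable_toSet _) fun b' _ => ?_
    refine Set.Subsingleton.countable ?_
    rintro t ⟨hb, ht⟩ s ⟨-, hs⟩
    have h1 : t • (b - b') = a' - a := by
      rw [smul_sub, sub_eq_sub_iff_add_eq_add, add_comm, ht]
    have h2 : s • (b - b') = a' - a := by
      rw [smul_sub, sub_eq_sub_iff_add_eq_add, add_comm, hs]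
    exact smul_left_injective ℝ (sub_ne_zero.2 hb) (h1.trans h2.symm)
  · intro t ht
    have hinj : ∀ x y, f x + t • g x = f y + t • g y → g x = g y := by
      intro x y hxy
      by_contra hne
      refine ht ?_
      simp only [Set.mem_iUnion]
      exact ⟨f x, f.mem_range_self x, f y, f.mem_range_self y, g x, g.mem_range_self x,
        g y, g.mem_range_self y, hne, hxy⟩
    refine ⟨fun y => if h : ∃ x, f x + t • g x = y then g h.choose else 0, ?_, ?_⟩
    · refine Measurable.measurable_of_countable_ne (measurable_const (a := (0 : X))) ?_
      refine Set.Countable.mono ?_ (f + t • g).finite_range.countable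
      intro y hy
      by_contra hcon
      refine hy ?_
      rw [dif_neg]
      rintro ⟨x, hx⟩
      exact hcon ⟨x, by simpa using hx⟩
    · intro x
      have hex : ∃ x', f x' + t • g x' = f x + t • g x := ⟨x, rfl⟩
      beta_reduce
      rw [dif_pos hex]
      exact hinj _ _ hex.choose_spec.symm

/-- fundamental theorem of calculus along segments in `L^p`. -/
lemma CB.ftc (H : CB p u Du) (hp : 1 ≤ p) {m : Measure X} [IsProbabilityMeasure m]
    [Fact (1 ≤ ENNReal.ofReal p)] (φ ψ : Lp X (ENNReal.ofReal p) m) :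
    ∫ t in (0 : ℝ)..1, pairH Du (φ + t • ψ) ψ = u (m.map ⇑(φ + ψ)) - u (m.map φ) := by
  refine DenseRange.induction_on₂
    (p := fun φ ψ : Lp X (ENNReal.ofReal p) m =>
      ∫ t in (0 : ℝ)..1, pairH Du (φ + t • ψ) ψ = u (m.map ⇑(φ + ψ)) - u (m.map φ))
    (Lp.simpleFunc.denseRange (E := X) (μ := m) (p := ENNReal.ofReal p) ENNReal.ofReal_ne_top)
    ?_ ?_ φ ψ
  · refine isClosed_eq ?_ ?_
    · refine intervalIntegral.continuous_parametric_intervalIntegral_of_continuous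
        (f := fun (q : Lp X (ENNReal.ofReal p) m × Lp X (ENNReal.ofReal p) m) (t : ℝ) =>
          pairH Du (q.1 + t • q.2) q.2) (s := fun _ => 1) ?_ continuous_const
      exact (H.pair_cont hp).comp (f := fun z : (Lp X (ENNReal.ofReal p) m ×
        Lp X (ENNReal.ofReal p) m) × ℝ => (z.1.1 + z.2 • z.1.2, z.1.2)) (by fun_prop)
    · exact ((H.u_cont hp).comp (continuous_fst.add continuous_snd)).sub
        ((H.u_cont hp).comp continuous_fst)
  · intro φ ψ
    obtain ⟨B, hB, hfac⟩ := simple_factor (Lp.simpleFunc.toSimpleFunc φ)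
      (Lp.simpleFunc.toSimpleFunc ψ)
    have hc : Continuous (fun t : ℝ => (φ : Lp X (ENNReal.ofReal p) m) + t •
      (ψ : Lp X (ENNReal.ofReal p) m)) := by fun_prop
    have := integral_eq_of_hasDerivAt_off_countable
      (fun s : ℝ => u (m.map ⇑((φ : Lp X (ENNReal.ofReal p) m) + s • (ψ : Lp X (ENNReal.ofReal p) m))))
      (fun t => pairH Du ((φ : Lp X (ENNReal.ofReal p) m) + t • (ψ : Lp X (ENNReal.ofReal p) m))
        (ψ : Lp X (ENNReal.ofReal p) m)) (a := 0) (b := 1) hB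
      ((H.u_cont hp).comp hc).continuousOn ?_
      (((H.pair_cont hp).comp (hc.prodMk continuous_const)).intervalIntegrable _ _)
    · simpa using this
    · rintro t ⟨-, ht⟩
      obtain ⟨Θ, hΘ, hx⟩ := hfac t ht
      refine H.deriv_factor hp _ _ t Θ hΘ ?_
      filter_upwards [Lp.simpleFunc.toSimpleFunc_eq_toFun φ, Lp.simpleFunc.toSimpleFunc_eq_toFun ψ,
        Lp.coeFn_add (φ : Lp X (ENNReal.ofReal p) m) (t • (ψ : Lp X (ENNReal.ofReal p) m)),
        Lp.coeFn_smul t (ψ : Lp X (ENNReal.ofReal p) m)] with x h1 h2 h3 h4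
      rw [h3, Pi.add_apply, h4, Pi.smul_apply, ← h1, ← h2]
      exact hx x

/-- If the derivative is norm-continuous then `u ∘ Ψ` is Fréchet differentiable. -/
lemma CB.frechet_of (H : CB p u Du) (hp : 1 ≤ p) {m : Measure X} [IsProbabilityMeasure m]
    [Fact (1 ≤ ENNReal.ofReal p)] (φ : Lp X (ENNReal.ofReal p) m) (ε : ℝ)
    (δ : ℝ)
    (h : ∀ χ ψ : Lp X (ENNReal.ofReal p) m, ‖χ‖ ≤ δ →
      |pairH Du (φ + χ) ψ - pairH Du φ ψ| ≤ ε * ‖ψ‖) (ψ : Lp X (ENNReal.ofReal p) m)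
    (hψ : ‖ψ‖ ≤ δ) :
    |u (m.map ⇑(φ + ψ)) - u (m.map φ) - pairH Du φ ψ| ≤ ε * ‖ψ‖ := by
  have hc : Continuous (fun t : ℝ => φ + t • ψ) := by fun_prop
  have hi : IntervalIntegrable (fun t : ℝ => pairH Du (φ + t • ψ) ψ) volume 0 1 :=
    ((H.pair_cont hp).comp (hc.prodMk continuous_const)).intervalIntegrable _ _
  have e : u (m.map ⇑(φ + ψ)) - u (m.map φ) - pairH Du φ ψ =
      ∫ t in (0 : ℝ)..1, (pairH Du (φ + t • ψ) ψ - pairH Du φ ψ) := by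
    rw [intervalIntegral.integral_sub hi (by simp), H.ftc hp]
    simp
  rw [e, ← Real.norm_eq_abs]
  refine (intervalIntegral.norm_integral_le_of_norm_le_const (C := ε * ‖ψ‖) ?_).trans_eq (by simp)
  intro t ht
  rw [Set.uIoc_of_le zero_le_one] at ht
  refine h _ _ ?_
  rw [norm_smul, Real.norm_of_nonneg ht.1.le]
  exact (mul_le_of_le_one_left (norm_nonneg _) ht.2).trans hψ

end formula
section strict
variable {X : Type*} [NormedAddCommGroup X] [NormedSpace ℝ X]
    [MeasurableSpace X] [BorelSpace X] [SecondCountableTopology X]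
variable {p : ℝ} {u : Measure X → ℝ} {Du : Measure X → X → (X →L[ℝ] ℝ)}

lemma CB.norm_cont_gt (H : CB p u Du) (hp1 : 1 < p) {m : Measure X} [IsProbabilityMeasure m]
    [Fact (1 ≤ ENNReal.ofReal p)] (φ : Lp X (ENNReal.ofReal p) m) (ε : ℝ) (hε : 0 < ε) :
    ∃ δ > 0, ∀ χ ψ : Lp X (ENNReal.ofReal p) m, ‖χ‖ ≤ δ →
      |pairH Du (φ + χ) ψ - pairH Du φ ψ| ≤ ε * ‖ψ‖ := by
  have hp := hp1.le
  obtain ⟨C, hC0, hC⟩ := H.bound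
  obtain ⟨q, hpq⟩ : ∃ q, p.HolderConjugate q := ⟨_, Real.HolderConjugate.conjExponent hp1⟩
  have hq0 : 0 < q := hpq.symm.pos
  have hdb : ∀ (f : Lp X (ENNReal.ofReal p) m) x,
      ‖Du (m.map f) (f x) - Du (m.map φ) (φ x)‖ ≤ 2 * C := fun f x =>
    (norm_sub_le _ _).trans (by
      have := hC _ (f x) (inPp_map hp f)
      have := hC _ (φ x) (inPp_map hp φ)
      linarith)
  have hdm : ∀ (f : Lp X (ENNReal.ofReal p) m), AEStronglyMeasurable (fun x =>
      ‖Du (m.map f) (f x) - Du (m.map φ) (φ x)‖) m := fun f =>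
    ((H.meas hp f).sub (H.meas hp φ)).norm
  have hN : Tendsto (fun f : Lp X (ENNReal.ofReal p) m =>
      (∫ x, ‖Du (m.map f) (f x) - Du (m.map φ) (φ x)‖ ^ q ∂m) ^ (1 / q)) (𝓝 φ) (𝓝 0) := by
    refine tendsto_of_subseq_tendsto fun ns hns => ?_
    obtain ⟨ms, hms, hae⟩ := H.subseq hp hns
    refine ⟨ms, ?_⟩
    have h1 : Tendsto (fun n => ∫ x, ‖Du (m.map (ns (ms n))) (ns (ms n) x) -
        Du (m.map φ) (φ x)‖ ^ q ∂m) atTop (𝓝 (∫ _, (0 : ℝ) ∂m)) := by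
      refine tendsto_integral_of_dominated_convergence (fun _ => (2 * C) ^ q)
        (fun n => ?_) (integrable_const _) (fun n => Eventually.of_forall fun x => ?_) ?_
      · exact ((hdm _).aemeasurable.pow_const q).aestronglyMeasurable
      · rw [Real.norm_of_nonneg (by positivity)]
        exact Real.rpow_le_rpow (norm_nonneg _) (hdb _ x) hq0.le
      · filter_upwards [hae] with x hx
        have := ((hx.sub_const (Du (m.map φ) (φ x))).norm).rpow_const (p := q) (Or.inr hq0.le)
        simpa [Real.zero_rpow hq0.ne'] using this
    have h2 := h1.rpow_const (p := 1 / q) (Or.inr (by positivity))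
    have hq1 : 1 / q ≠ 0 := by positivity
    simpa [Real.zero_rpow, hq1, hq0.ne'] using h2
  obtain ⟨δ, hδ, hball⟩ := Metric.eventually_nhds_iff.1 (hN.eventually (gt_mem_nhds hε))
  refine ⟨δ / 2, by positivity, fun χ ψ hχ => ?_⟩
  have hlt := hball (y := φ + χ) (by rw [dist_eq_norm]; simp; linarith)
  have e : pairH Du (φ + χ) ψ - pairH Du φ ψ =
      ∫ x, (Du (m.map ⇑(φ + χ)) ((φ + χ : Lp X (ENNReal.ofReal p) m) x) -
        Du (m.map φ) (φ x)) (ψ x) ∂m :=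
    (integral_sub (H.pair_int hp _ ψ) (H.pair_int hp φ ψ)).symm
  rw [e, ← Real.norm_eq_abs]
  have hmd : MemLp (fun x => ‖Du (m.map ⇑(φ + χ)) ((φ + χ : Lp X (ENNReal.ofReal p) m) x) -
        Du (m.map φ) (φ x)‖) (ENNReal.ofReal q) m :=
    MemLp.of_bound (hdm _) (2 * C) (Eventually.of_forall fun x => by
      rw [norm_norm]; exact hdb _ x)
  have hI : Integrable (fun x => ‖Du (m.map ⇑(φ + χ)) ((φ + χ : Lp X (ENNReal.ofReal p) m) x) -
        Du (m.map φ) (φ x)‖ * ‖ψ x‖) m := by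
    refine ((Lp_integrable hp ψ).norm.const_mul (2 * C)).mono'
      ((hdm _).mul (Lp.aestronglyMeasurable ψ).norm) (Eventually.of_forall fun x => ?_)
    rw [Real.norm_of_nonneg (by positivity)]
    exact mul_le_mul_of_nonneg_right (hdb _ x) (norm_nonneg _)
  refine (norm_integral_le_of_norm_le hI (Eventually.of_forall fun x =>
    ContinuousLinearMap.le_opNorm _ _)).trans ?_
  refine (integral_mul_le_Lp_mul_Lq_of_nonneg hpq.symm
    (Eventually.of_forall fun x => norm_nonneg _) (Eventually.of_forall fun x => norm_nonneg _)
    hmd (Lp.memLp ψ).norm).trans ?_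
  rw [← Lp_norm_eq hp]
  exact mul_le_mul_of_nonneg_right hlt.le (norm_nonneg _)

end strict
section endpoint
variable {X : Type*} [NormedAddCommGroup X] [NormedSpace ℝ X]
    [MeasurableSpace X] [BorelSpace X] [SecondCountableTopology X]
variable {u : Measure X → ℝ} {Du : Measure X → X → (X →L[ℝ] ℝ)}

/-- the case `p = 1`: an averaged identity at accumulation points of atoms. -/
lemma CB.avg_eq (H : CB 1 u Du) [Fact (1 ≤ ENNReal.ofReal 1)] {ν : Measure X} (hν : InPp 1 ν)
    {x : X} {z : ℕ → X} (hz : Tendsto z atTop (𝓝 x)) (hinj : Function.Injective z)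
    (hpos : ∀ n, ν {z n} ≠ 0) (k : X) :
    ∫ t in (0 : ℝ)..1, Du ν (x + t • k) k = Du ν x k := by
  haveI := hν.1
  have h11 : (1 : ℝ) ≤ 1 := le_rfl
  obtain ⟨C, hC0, hC⟩ := H.bound
  -- the identity as an element of `L^1`
  have hid : MemLp (fun y : X => y) (ENNReal.ofReal 1) ν := by
    rw [← integrable_norm_rpow_iff (by fun_prop) (ofReal_ne_zero' h11) ENNReal.ofReal_ne_top,
      ENNReal.toReal_ofReal zero_le_one]
    exact hν.2
  set f : Lp X (ENNReal.ofReal 1) ν := hid.toLp with hf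
  have hfc : f =ᵐ[ν] fun y => y := hid.coeFn_toLp
  have hmapf : ν.map f = ν := by
    rw [Measure.map_congr hfc]; exact Measure.map_id
  set ψ : ℕ → Lp X (ENNReal.ofReal 1) ν := fun n =>
    indicatorConstLp _ (measurableSet_singleton (z n)) (measure_ne_top ν _) k with hψ
  have hψc : ∀ n, ψ n =ᵐ[ν] ({z n} : Set X).indicator fun _ => k := fun n =>
    indicatorConstLp_coeFn
  set c : ℕ → ℝ := fun n => ν.real {z n} with hc
  have hcpos : ∀ n, 0 < c n := fun n =>
    ENNReal.toReal_pos (hpos n) (measure_ne_top ν _)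
  have hc0 : Tendsto c atTop (𝓝 0) := by
    have h1 : ∑' n, ν {z n} ≠ ⊤ := by
      refine ne_top_of_le_ne_top (measure_ne_top ν Set.univ)
        (tsum_measure_le_measure_univ (fun n => (measurableSet_singleton _).nullMeasurableSet) ?_)
      intro i j hij
      refine Disjoint.aedisjoint ?_
      simpa using fun h => hij (hinj h)
    have h2 := ENNReal.tendsto_cofinite_zero_of_tsum_ne_top h1
    rw [Nat.cofinite_eq_atTop] at h2
    have h3 := (ENNReal.tendsto_toReal (a := 0) (by simp)).comp h2
    rw [ENNReal.toReal_zero] at h3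
    exact h3
  have hnorm : ∀ n, ‖ψ n‖ = ‖k‖ * c n := fun n => by
    rw [hψ]
    simp only
    rw [norm_indicatorConstLp (ofReal_ne_zero' h11) ENNReal.ofReal_ne_top]
    simp [hc]
  have hψ0 : Tendsto (fun n => ‖ψ n‖) atTop (𝓝 0) := by
    simp only [hnorm]
    simpa using hc0.const_mul ‖k‖
  have hpair : ∀ n (t : ℝ), pairH Du (f + t • ψ n) (ψ n) =
      c n * Du (ν.map ⇑(f + t • ψ n)) (z n + t • k) k := by
    intro n t
    have e := integral_indicator_const (μ := ν)
      (Du (ν.map ⇑(f + t • ψ n)) (z n + t • k) k) (measurableSet_singleton (z n))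
    rw [smul_eq_mul] at e
    rw [hc, ← e]
    refine integral_congr_ae ?_
    filter_upwards [hfc, hψc n, Lp.coeFn_add f (t • ψ n), Lp.coeFn_smul t (ψ n)] with y h1 h2 h3 h4
    rw [h3, Pi.add_apply, h4, Pi.smul_apply, h1, h2]
    by_cases hy : y = z n
    · subst hy; simp
    · have : y ∉ ({z n} : Set X) := hy
      simp [Set.indicator_of_notMem this]
  set a : ℕ → ℝ → ℝ := fun n t => Du (ν.map ⇑(f + t • ψ n)) (z n + t • k) k with ha
  have ha' : ∀ n t, a n t = (c n)⁻¹ * pairH Du (f + t • ψ n) (ψ n) := fun n t => by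
    rw [hpair, inv_mul_cancel_left₀ (hcpos n).ne']
  have hacont : ∀ n, Continuous (a n) := fun n => by
    have hc : Continuous (fun t : ℝ => f + t • ψ n) := by fun_prop
    have := ((H.pair_cont h11).comp (hc.prodMk (continuous_const (y := ψ n)))).const_mul (c n)⁻¹
    refine this.congr fun t => (ha' n t).symm
  have hlim1 : Tendsto (fun n => ∫ t in (0 : ℝ)..1, a n t) atTop
      (𝓝 (∫ t in (0 : ℝ)..1, Du ν (x + t • k) k)) := by
    refine intervalIntegral.tendsto_integral_filter_of_dominated_convergence (fun _ => C * ‖k‖)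
      (Eventually.of_forall fun n => (hacont n).aestronglyMeasurable)
      (Eventually.of_forall fun n => Eventually.of_forall fun t _ => ?_) (by simp)
      (Eventually.of_forall fun t _ => ?_)
    · exact (ContinuousLinearMap.le_opNorm _ _).trans
        (mul_le_mul_of_nonneg_right (hC _ _ (inPp_map h11 _)) (norm_nonneg _))
    · have h1 : Tendsto (fun n => Du (ν.map ⇑(f + t • ψ n)) (z n + t • k)) atTop
          (𝓝 (Du ν (x + t • k))) := by
        refine H.tendsto hν (fun n => inPp_map h11 _) (w := fun n => |t| * ‖ψ n‖) (fun n => ?_) ?_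
          (hz.add_const _)
        · have := Wp_Lp_le h11 f (f + t • ψ n)
          rw [hmapf] at this
          refine this.trans_eq ?_
          rw [sub_add_cancel_left, norm_neg, norm_smul, Real.norm_eq_abs]
        · simpa using hψ0.const_mul |t|
      exact ((ContinuousLinearMap.apply ℝ ℝ k).continuous.tendsto _).comp h1
  have hlim2 : Tendsto (fun n => Du ν (z n) k) atTop (𝓝 (Du ν x k)) :=
    ((ContinuousLinearMap.apply ℝ ℝ k).continuous.tendsto _).comp
      (((H.cont h11 hν).tendsto x).comp hz)
  have hlim3 : Tendsto (fun n => (∫ t in (0 : ℝ)..1, a n t) - Du ν (z n) k) atTop (𝓝 0) := by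
    rw [Metric.tendsto_nhds]
    intro ε hε
    have hK : 0 < ‖k‖ + 1 := by positivity
    obtain ⟨δ, hδ, h⟩ := H.taylor_factor h11 f (ε / (‖k‖ + 1)) (by positivity)
    filter_upwards [hψ0.eventually (gt_mem_nhds hδ)] with n hn
    have h1 := h (ψ n) (({z n} : Set X).indicator fun _ => k)
      (measurable_const.indicator (measurableSet_singleton _)) ?_ hn.le
    · have e0 : pairH Du f (ψ n) = c n * Du ν (z n) k := by
        have := hpair n 0
        simpa [hmapf] using this
      have e1 : ∫ t in (0 : ℝ)..1, pairH Du (f + t • ψ n) (ψ n) =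
          c n * ∫ t in (0 : ℝ)..1, a n t := by
        rw [← intervalIntegral.integral_const_mul]
        exact intervalIntegral.integral_congr fun t _ => hpair n t
      rw [← H.ftc h11, e0, e1, hnorm, ← mul_sub, abs_mul, abs_of_pos (hcpos n)] at h1
      rw [dist_zero_right, Real.norm_eq_abs]
      have h2 : c n * |(∫ t in (0 : ℝ)..1, a n t) - Du ν (z n) k| ≤
          c n * (ε / (‖k‖ + 1) * ‖k‖) := by linarith
      have h3 := le_of_mul_le_mul_left h2 (hcpos n)
      refine h3.trans_lt ?_
      rw [div_mul_eq_mul_div, div_lt_iff₀ hK]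
      nlinarith
    · filter_upwards [hfc, hψc n] with y h1 h2
      rw [h1, h2]
  have := tendsto_nhds_unique (hlim1.sub hlim2) hlim3
  linarith

lemma CB.ray_eq (H : CB 1 u Du) [Fact (1 ≤ ENNReal.ofReal 1)] {ν : Measure X} (hν : InPp 1 ν)
    {x : X} {z : ℕ → X} (hz : Tendsto z atTop (𝓝 x)) (hinj : Function.Injective z)
    (hpos : ∀ n, ν {z n} ≠ 0) (h : X) : Du ν (x + h) h = Du ν x h := by
  have hcont : Continuous (fun r : ℝ => Du ν (x + r • h) h) :=
    ((H.cont le_rfl hν).comp (by fun_prop : Continuous fun r : ℝ => x + r • h)).clm_apply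
      continuous_const
  have e : ∀ s : ℝ, ∫ r in (0 : ℝ)..s, Du ν (x + r • h) h = s * Du ν x h := by
    intro s
    have h1 := H.avg_eq hν hz hinj hpos (s • h)
    have h2 := intervalIntegral.smul_integral_comp_mul_right (a := 0) (b := 1)
      (fun r : ℝ => Du ν (x + r • h) h) s
    rw [zero_mul, one_mul] at h2
    rw [← h2]
    simp only [smul_smul, map_smul, smul_eq_mul] at h1 ⊢
    rw [intervalIntegral.integral_const_mul] at h1
    exact h1
  have d1 := (hcont.integral_hasStrictDerivAt 0 1).hasDerivAt
  simp only [e] at d1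
  have d2 : HasDerivAt (fun s : ℝ => s * Du ν x h) (1 * Du ν x h) 1 :=
    (hasDerivAt_id (1 : ℝ)).mul_const _
  have := d1.unique d2
  simpa using this

lemma mix_inPp {μ l : Measure X} (hμ : InPp 1 μ) (hl : InPp 1 l) {e : ℝ} (he0 : 0 ≤ e)
    (he1 : e ≤ 1) : InPp 1 (ENNReal.ofReal (1 - e) • μ + ENNReal.ofReal e • l) := by
  haveI := hμ.1
  haveI := hl.1
  refine ⟨⟨?_⟩, ?_⟩
  · simp [← ENNReal.ofReal_add (sub_nonneg.2 he1) he0]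
  · exact (hμ.2.smul_measure ENNReal.ofReal_ne_top).add_measure
      (hl.2.smul_measure ENNReal.ofReal_ne_top)

lemma mix_Wp {μ l : Measure X} (hμ : InPp 1 μ) (hl : InPp 1 l) {e : ℝ} (he0 : 0 < e)
    (he1 : e ≤ 1) : Wp 1 μ (ENNReal.ofReal (1 - e) • μ + ENNReal.ofReal e • l) ≤
      e * ∫ z, ‖z.1 - z.2‖ ^ (1 : ℝ) ∂(μ.prod l) := by
  haveI := hμ.1
  haveI := hl.1
  have hd : Measurable (fun x : X => (x, x)) := by fun_prop
  have hsum : ENNReal.ofReal (1 - e) + ENNReal.ofReal e = 1 := by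
    simp [← ENNReal.ofReal_add (sub_nonneg.2 he1) he0.le]
  set π : Measure (X × X) := ENNReal.ofReal (1 - e) • μ.map (fun x => (x, x)) +
    ENNReal.ofReal e • μ.prod l with hπ
  haveI : IsProbabilityMeasure (μ.map (fun x : X => (x, x))) :=
    Measure.isProbabilityMeasure_map hd.aemeasurable
  haveI : IsProbabilityMeasure π := ⟨by simp [hπ, hsum]⟩
  have hK : 0 ≤ ∫ z, ‖z.1 - z.2‖ ^ (1 : ℝ) ∂(μ.prod l) :=
    integral_nonneg fun z => Real.rpow_nonneg (norm_nonneg _) _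
  refine (Wp_le_of_coupling π ?_ ?_).trans ?_
  · rw [hπ, Measure.map_add _ _ measurable_fst, Measure.map_smul, Measure.map_smul,
      Measure.map_fst_prod, Measure.map_map measurable_fst hd]
    have : (Prod.fst ∘ fun x : X => (x, x)) = id := rfl
    rw [this, Measure.map_id, measure_univ, one_smul, ← add_smul, hsum, one_smul]
  · rw [hπ, Measure.map_add _ _ measurable_snd, Measure.map_smul, Measure.map_smul,
      Measure.map_snd_prod, Measure.map_map measurable_snd hd]
    have : (Prod.snd ∘ fun x : X => (x, x)) = id := rfl
    rw [this, Measure.map_id, measure_univ, one_smul]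
  · rw [one_div_one, Real.rpow_one]
    by_cases hi : Integrable (fun z : X × X => ‖z.1 - z.2‖ ^ (1 : ℝ)) π
    · have hi' := hi
      rw [hπ, integrable_add_measure] at hi'
      rw [hπ, integral_add_measure hi'.1 hi'.2, integral_smul_measure, integral_smul_measure,
        integral_map hd.aemeasurable (Measurable.pow_const (by fun_prop) _).aestronglyMeasurable,
        ENNReal.toReal_ofReal he0.le]
      simp
    · rw [integral_undef hi]
      positivity

lemma CB.ray_eq' (H : CB 1 u Du) [Fact (1 ≤ ENNReal.ofReal 1)] {μ : Measure X} (hμ : InPp 1 μ)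
    (x h : X) : Du μ (x + h) h = Du μ x h := by
  rcases eq_or_ne h 0 with rfl | hh
  · simp
  set z : ℕ → X := fun n => x + (1 / ((n : ℝ) + 1)) • h with hz
  have hzt : Tendsto z atTop (𝓝 x) := by
    have := (tendsto_one_div_add_atTop_nhds_zero_nat (𝕜 := ℝ)).smul_const h
    simpa [hz] using this.const_add x
  have hinj : Function.Injective z := by
    intro i j hij
    have h1 := smul_left_injective ℝ hh (add_left_cancel hij)
    have h2 : ((i : ℝ) + 1) = j + 1 := by
      have := congrArg (fun r : ℝ => r⁻¹) h1
      simpa using this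
    exact_mod_cast add_right_cancel h2
  have hzm : Measurable z := measurable_of_countable z
  set m : Measure ℕ := ProbabilityTheory.poissonMeasure 1 with hm
  set l : Measure X := m.map z with hl
  have hlP : InPp 1 l := by
    refine ⟨Measure.isProbabilityMeasure_map hzm.aemeasurable, ?_⟩
    rw [hl, integrable_map_measure (Measurable.pow_const (by fun_prop) _).aestronglyMeasurable
      hzm.aemeasurable]
    refine Integrable.of_bound (measurable_of_countable _).aestronglyMeasurable (‖x‖ + ‖h‖)
      (Eventually.of_forall fun n => ?_)
    simp only [Function.comp, Real.rpow_one, norm_norm]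
    refine (norm_add_le _ _).trans ?_
    rw [norm_smul]
    have : ‖1 / ((n : ℝ) + 1)‖ ≤ 1 := by
      rw [Real.norm_of_nonneg (by positivity), div_le_one (by positivity)]
      have : (0 : ℝ) ≤ n := by positivity
      linarith
    have := mul_le_of_le_one_left (norm_nonneg h) this
    linarith
  have hlpos : ∀ n, l {z n} ≠ 0 := by
    intro n
    rw [hl, Measure.map_apply hzm (measurableSet_singleton _)]
    have h1 := ProbabilityTheory.poissonMeasure_real_singleton_pos (r := 1) n one_pos
    have h2 : m {n} ≠ 0 := fun h0 => by
      rw [measureReal_def, ← hm, h0] at h1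
      simp at h1
    refine fun h0 => h2 (measure_mono_null ?_ h0)
    simp
  set e : ℕ → ℝ := fun n => 1 / ((n : ℝ) + 1) with he
  have he0 : ∀ n, 0 < e n := fun n => by simp only [he]; positivity
  have he1 : ∀ n, e n ≤ 1 := fun n => by
    simp only [he]
    rw [div_le_one (by positivity)]
    have : (0 : ℝ) ≤ n := by positivity
    linarith
  have het : Tendsto e atTop (𝓝 0) := tendsto_one_div_add_atTop_nhds_zero_nat
  set ν : ℕ → Measure X := fun n => ENNReal.ofReal (1 - e n) • μ + ENNReal.ofReal (e n) • l with hν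
  have hνP : ∀ n, InPp 1 (ν n) := fun n => mix_inPp hμ hlP (he0 n).le (he1 n)
  have hlim : ∀ y, Tendsto (fun n => Du (ν n) y h) atTop (𝓝 (Du μ y h)) := by
    intro y
    have h1 : Tendsto (fun n => Du (ν n) y) atTop (𝓝 (Du μ y)) := by
      refine H.tendsto hμ hνP (fun n => mix_Wp hμ hlP (he0 n) (he1 n)) ?_ tendsto_const_nhds
      simpa using het.mul_const (∫ z, ‖z.1 - z.2‖ ^ (1 : ℝ) ∂(μ.prod l))
    exact ((ContinuousLinearMap.apply ℝ ℝ h).continuous.tendsto _).comp h1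
  refine tendsto_nhds_unique (hlim (x + h)) ((hlim x).congr fun n => ?_)
  refine (H.ray_eq (hνP n) hzt hinj (fun j => ?_) h).symm
  have hne : ENNReal.ofReal (e n) ≠ 0 := by simpa using he0 n
  simp [hν, hne, hlpos j]

lemma CB.const (H : CB 1 u Du) [Fact (1 ≤ ENNReal.ofReal 1)] {μ : Measure X} (hμ : InPp 1 μ)
    (x : X) : Du μ x = Du μ 0 := by
  obtain ⟨C, hC0, hC⟩ := H.bound
  have key : ∀ x y, (Du μ y - Du μ 0) x = - (Du μ x - Du μ 0) y := by
    intro x y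
    have h1 := H.ray_eq' hμ x (y - x)
    have h2 := H.ray_eq' hμ 0 x
    have h3 := H.ray_eq' hμ 0 y
    rw [add_sub_cancel] at h1
    rw [zero_add] at h2 h3
    simp only [map_sub] at h1
    simp only [ContinuousLinearMap.sub_apply]
    linarith
  ext y
  by_contra hne
  have hpos : 0 < |(Du μ x - Du μ 0) y| := by
    rw [abs_pos, ContinuousLinearMap.sub_apply]
    exact sub_ne_zero.2 hne
  obtain ⟨N, hN⟩ := exists_nat_gt (2 * C * ‖x‖ / |(Du μ x - Du μ 0) y|)
  rw [div_lt_iff₀ hpos] at hN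
  have h1 := key x ((N : ℝ) • y)
  have h2 : |(Du μ ((N : ℝ) • y) - Du μ 0) x| ≤ 2 * C * ‖x‖ := by
    rw [← Real.norm_eq_abs]
    refine (ContinuousLinearMap.le_opNorm _ _).trans
      (mul_le_mul_of_nonneg_right ((norm_sub_le _ _).trans ?_) (norm_nonneg _))
    have := hC μ ((N : ℝ) • y) hμ
    have := hC μ 0 hμ
    linarith
  rw [h1, map_smul, abs_neg, smul_eq_mul, abs_mul, Nat.abs_cast] at h2
  linarith

lemma CB.norm_cont_one (H : CB 1 u Du) {m : Measure X} [IsProbabilityMeasure m]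
    [Fact (1 ≤ ENNReal.ofReal 1)] (φ : Lp X (ENNReal.ofReal 1) m) (ε : ℝ) (hε : 0 < ε) :
    ∃ δ > 0, ∀ χ ψ : Lp X (ENNReal.ofReal 1) m, ‖χ‖ ≤ δ →
      |pairH Du (φ + χ) ψ - pairH Du φ ψ| ≤ ε * ‖ψ‖ := by
  have hp : (1 : ℝ) ≤ 1 := le_rfl
  obtain ⟨δ, hδ, h⟩ := H.contD _ 0 (inPp_map hp φ) ε hε
  refine ⟨δ / 2, by positivity, fun χ ψ hχ => ?_⟩
  have hW : Wp 1 (m.map φ) (m.map ⇑(φ + χ)) < δ := by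
    refine (Wp_Lp_le hp φ (φ + χ)).trans_lt ?_
    rw [sub_add_cancel_left, norm_neg]
    linarith
  have hd := h _ 0 (inPp_map hp (φ + χ)) hW (by simpa using hδ)
  have e : pairH Du (φ + χ) ψ - pairH Du φ ψ =
      ∫ x, (Du (m.map ⇑(φ + χ)) ((φ + χ : Lp X (ENNReal.ofReal 1) m) x) -
        Du (m.map φ) (φ x)) (ψ x) ∂m :=
    (integral_sub (H.pair_int hp _ ψ) (H.pair_int hp φ ψ)).symm
  rw [e, ← Real.norm_eq_abs]
  refine (norm_integral_le_of_norm_le ((Lp_integrable hp ψ).norm.const_mul ε)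
    (Eventually.of_forall fun x => ?_)).trans ?_
  · rw [H.const (inPp_map hp (φ + χ)), H.const (inPp_map hp φ) (φ x)]
    exact (ContinuousLinearMap.le_opNorm _ _).trans
      (mul_le_mul_of_nonneg_right hd.le (norm_nonneg _))
  · rw [integral_const_mul]
    exact mul_le_mul_of_nonneg_left (Lp_integral_le hp ψ) hε.le

end endpoint

/-- Chain rule: for `u ∈ C_b^1(𝒫_p)` the composition `u ∘ Ψ` with
`Ψ φ = μ₀ ∘ φ⁻¹` is Fréchet differentiable on `T₀ = L^p(X → X, μ₀)` with
`∇(u ∘ Ψ)(φ) = Du(Ψ(φ)) ∘ φ`, and the `L^{p*}` norms coincide. -/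
theorem stmt12 {X : Type*} [NormedAddCommGroup X] [NormedSpace ℝ X]
    [MeasurableSpace X] [BorelSpace X] [SecondCountableTopology X] [CompleteSpace X]
    (hrefl : Function.Surjective ⇑(NormedSpace.inclusionInDoubleDual ℝ X))
    (p : ℝ) (hp : 1 ≤ p)
    (μ0 : Measure X) [IsProbabilityMeasure μ0]
    (hμ0 : Integrable (fun x => ‖x‖ ^ p) μ0)
    (u : Measure X → ℝ) (Du : Measure X → X → (X →L[ℝ] ℝ))
    -- `|u| + ‖Du‖` is bounded on `𝒫_p × X`
    (hbdd : ∃ C : ℝ, ∀ μ : Measure X, ∀ x : X, InPp p μ → |u μ| + ‖Du μ x‖ ≤ C)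
    -- `u` is continuous on `(𝒫_p, 𝕎_p)`
    (hcontu : ∀ μ : Measure X, InPp p μ → ∀ ε : ℝ, 0 < ε → ∃ δ : ℝ, 0 < δ ∧
      ∀ ν : Measure X, InPp p ν → Wp p μ ν < δ → |u ν - u μ| < ε)
    -- first-order Taylor expansion of `u` along pushforwards, with derivative `Du`
    (hTaylor : ∀ μ : Measure X, InPp p μ → ∀ ε : ℝ, 0 < ε → ∃ δ : ℝ, 0 < δ ∧
      ∀ φ : X → X, Measurable φ → Integrable (fun x => ‖φ x‖ ^ p) μ →
        (∫ x, ‖φ x‖ ^ p ∂μ) ^ (1 / p) ≤ δ →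
        abs (u (μ.map (fun x => x + φ x)) - u μ - ∫ x, Du μ x (φ x) ∂μ) ≤
          ε * (∫ x, ‖φ x‖ ^ p ∂μ) ^ (1 / p))
    -- joint continuity of `Du` in `(μ, x)`
    (hcontD : ∀ (μ : Measure X) (x : X), InPp p μ → ∀ ε : ℝ, 0 < ε →
      ∃ δ : ℝ, 0 < δ ∧ ∀ (ν : Measure X) (y : X), InPp p ν →
        Wp p μ ν < δ → ‖y - x‖ < δ → ‖Du ν y - Du μ x‖ < ε) :
    ∀ φ : Lp X (ENNReal.ofReal p) μ0,
      -- Fréchet differentiability of `u ∘ Ψ` at `φ` with derivative `Du(Ψ φ) ∘ φ`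
      (∀ ε : ℝ, 0 < ε → ∃ δ : ℝ, 0 < δ ∧ ∀ ψ : Lp X (ENNReal.ofReal p) μ0, ‖ψ‖ ≤ δ →
        abs (u (μ0.map ⇑(φ + ψ)) - u (μ0.map ⇑φ) -
          ∫ x, Du (μ0.map ⇑φ) (φ x) (ψ x) ∂μ0) ≤ ε * ‖ψ‖) ∧
      -- equality of the `L^{p*}` norms of `∇(u∘Ψ)(φ)` and `Du(Ψ(φ))`
      eLpNorm (fun x => Du (μ0.map ⇑φ) (φ x))
          (if p = 1 then (⊤ : ℝ≥0∞) else ENNReal.ofReal (p / (p - 1))) μ0 =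
        eLpNorm (fun y => Du (μ0.map ⇑φ) y)
          (if p = 1 then (⊤ : ℝ≥0∞) else ENNReal.ofReal (p / (p - 1)))
          (μ0.map ⇑φ) := by
  intro φ
  have H : CB p u Du := ⟨hbdd, hcontu, hTaylor, hcontD⟩
  haveI : Fact (1 ≤ ENNReal.ofReal p) := ⟨by simpa using ENNReal.ofReal_le_ofReal hp⟩
  refine ⟨fun ε hε => ?_, ?_⟩
  · obtain ⟨δ, hδ, h⟩ : ∃ δ > 0, ∀ χ ψ : Lp X (ENNReal.ofReal p) μ0, ‖χ‖ ≤ δ →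
        |pairH Du (φ + χ) ψ - pairH Du φ ψ| ≤ ε * ‖ψ‖ := by
      rcases hp.eq_or_lt with h1 | h1
      · subst h1
        exact H.norm_cont_one φ ε hε
      · exact H.norm_cont_gt h1 φ ε hε
    exact ⟨δ, hδ, fun ψ hψ => H.frechet_of hp φ ε δ h ψ hψ⟩
  · rw [eLpNorm_map_measure (H.cont hp (inPp_map hp φ)).aestronglyMeasurable
      (Lp_meas φ).aemeasurable]
    rfl
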